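/- arXiv:1104.0388 — 2 statements merged into one kernel-verified Lean document; each statement's English description precedes it below -/
import Mathlib

section
/- Let k ≥ 4 and let w be a word over Σ = {a,b}. If words p, q ∈ {u, v} occur in w at positions s and t respectively with s < t < s + k (i.e. the two occurrences overlap), then p = v, q = u, and t = s + k − 2; in particular, the overlapped factor of w starting at position s is b^{k−1} a^{k−1}. -/
namespace Restivo

/-- Words over the two-letter alphabet Σ = {a, b}, encoded as lists of booleans. -/
abbrev Word := List Bool

/-- The letter `a`. -/
def a : Bool := false

/-- The letter `b`. -/
def b : Bool := true

/-- Kleene star: all finite concatenations of words from `S` (including the empty word). -/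
def kstar (S : Set Word) : Set Word :=
  { w | ∃ L : List Word, (∀ x ∈ L, x ∈ S) ∧ L.flatten = w }

/-- Prefixes of words of `L`. -/
def Pref (L : Set Word) : Set Word := { w | ∃ z : Word, w ++ z ∈ L }

/-- Factors (contiguous subwords) of words of `L`. -/
def Facts (L : Set Word) : Set Word := { w | ∃ x y : Word, x ++ w ++ y ∈ L }

/-- The word u = b a^(k-1). -/
def u (k : ℕ) : Word := b :: List.replicate (k - 1) a

/-- The word v = b^(k-1) a. -/
def v (k : ℕ) : Word := List.replicate (k - 1) b ++ [a]

/-- The set S_k = (Σ^k \ {u, v}) ∪ (Σ^(k-1) \ {a^(k-1), b^(k-1)}). -/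
def Sk (k : ℕ) : Set Word :=
  { w | w.length = k ∧ w ≠ u k ∧ w ≠ v k } ∪
  { w | w.length = k - 1 ∧ w ≠ List.replicate (k - 1) a ∧ w ≠ List.replicate (k - 1) b }

/-- Position `j` is forbidden in `w` w.r.t. `S` if the suffix of `w` starting from
position `j` is not a prefix of any word of `S*`. -/
def Forbidden (S : Set Word) (w : Word) (j : ℕ) : Prop :=
  w.drop j ∉ Pref (kstar S)

/-- The word `p` occurs in `w` at position `s`. -/
def OccursAt (p w : Word) (s : ℕ) : Prop :=
  s + p.length ≤ w.length ∧ (w.drop s).take p.length = p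

/-- The set of (locally enumerated) forbidden positions of the occurrence of `p`
at position `s` in `w`, with respect to `S_k`. -/
def Focc (k : ℕ) (w p : Word) (s : ℕ) : Set ℕ :=
  { i | i < p.length ∧ Forbidden (Sk k) w (s + i) }

/-- Two occurrences (of words from {u, v}) at positions `s < t` in `w` are
consecutive: no word from {u, v} occurs at a position strictly between them. -/
def Consecutive (k : ℕ) (w : Word) (s t : ℕ) : Prop :=
  s < t ∧ ∀ m, s < m → m < t → ¬ OccursAt (u k) w m ∧ ¬ OccursAt (v k) w m

/-- `w` is a minimal uncompletable word for `S`. -/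
def MinUncompletable (S : Set Word) (w : Word) : Prop :=
  w ∉ Facts (kstar S) ∧ ∀ w' : Word, w' ∉ Facts (kstar S) → w.length ≤ w'.length

/-- The letters of an occurrence of `p` in `w`. -/
theorem OccursAt.getElem? {p w : Word} {s i : ℕ} (h : OccursAt p w s) (hi : i < p.length) :
    w[s + i]? = p[i]? := by
  conv_rhs => rw [← h.2]
  rw [List.getElem?_take_of_lt hi, List.getElem?_drop]

theorem length_u {k : ℕ} (hk : 1 ≤ k) : (u k).length = k := by
  simp [u]; omega

theorem length_v {k : ℕ} (hk : 1 ≤ k) : (v k).length = k := by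
  simp [v]; omega

theorem OccursAt.u_head {k s : ℕ} {w : Word} (hk : 1 ≤ k) (h : OccursAt (u k) w s) :
    w[s]? = some b := by
  have := h.getElem? (i := 0) (by rw [length_u hk]; omega)
  simpa [u] using this

theorem OccursAt.u_tail {k s j : ℕ} {w : Word} (h : OccursAt (u k) w s)
    (hs : s < j) (hj : j < s + k) : w[j]? = some a := by
  obtain ⟨i, rfl⟩ : ∃ i, j = s + (i + 1) := ⟨j - s - 1, by omega⟩
  rw [h.getElem? (by rw [length_u (by omega)]; omega), u, List.getElem?_cons_succ,
    List.getElem?_replicate_of_lt (by omega)]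

theorem OccursAt.v_initial {k s j : ℕ} {w : Word} (h : OccursAt (v k) w s)
    (hs : s ≤ j) (hj : j < s + (k - 1)) : w[j]? = some b := by
  obtain ⟨i, rfl⟩ : ∃ i, j = s + i := ⟨j - s, by omega⟩
  rw [h.getElem? (by rw [length_v (by omega)]; omega), v,
    List.getElem?_append_left (by simp; omega), List.getElem?_replicate_of_lt (by omega)]

theorem OccursAt.v_last {k s : ℕ} {w : Word} (hk : 1 ≤ k) (h : OccursAt (v k) w s) :
    w[s + (k - 1)]? = some a := by
  rw [h.getElem? (by rw [length_v hk]; omega), v, List.getElem?_append_right (by simp)]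
  simp

theorem not_some_a_and_some_b {x : Option Bool} (ha : x = some a) (hb : x = some b) : False := by
  simp [ha, a, b] at hb

theorem statement9 (k : ℕ) (hk : 4 ≤ k) (w p q : Word)
    (hp : p = u k ∨ p = v k) (hq : q = u k ∨ q = v k)
    (s t : ℕ) (hop : OccursAt p w s) (hoq : OccursAt q w t)
    (h1 : s < t) (h2 : t < s + k) :
    p = v k ∧ q = u k ∧ t = s + (k - 2) ∧
      (w.drop s).take (2 * k - 2) =
        List.replicate (k - 1) b ++ List.replicate (k - 1) a := by
  have hk1 : 1 ≤ k := by omega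
  rcases hp with rfl | rfl
  · have ha : w[t]? = some a := hop.u_tail h1 h2
    rcases hq with rfl | rfl
    · exact (not_some_a_and_some_b ha (hoq.u_head hk1)).elim
    · exact (not_some_a_and_some_b ha (hoq.v_initial le_rfl (by omega))).elim
  · rcases hq with rfl | rfl
    · have ht : t = s + (k - 2) := by
        by_contra hne
        rcases (by omega : t = s + (k - 1) ∨ t + 1 < s + (k - 1)) with rfl | hlt
        · exact not_some_a_and_some_b (hop.v_last hk1) (hoq.u_head hk1)
        · exact not_some_a_and_some_b (hoq.u_tail (Nat.lt_succ_self t) (by omega))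
            (hop.v_initial (by omega) hlt)
      refine ⟨rfl, rfl, ht, List.ext_getElem? fun i => ?_⟩
      rcases (by omega : i < k - 1 ∨ (k - 1 ≤ i ∧ i < 2 * k - 2) ∨ 2 * k - 2 ≤ i)
        with hi | ⟨hi, hi'⟩ | hi
      · rw [List.getElem?_take_of_lt (by omega), List.getElem?_drop,
          hop.v_initial (by omega) (by omega), List.getElem?_append_left (by simpa using hi),
          List.getElem?_replicate_of_lt hi]
      · rw [List.getElem?_take_of_lt hi', List.getElem?_drop,
          hoq.u_tail (by omega) (by omega), List.getElem?_append_right (by simpa using hi),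
          List.length_replicate, List.getElem?_replicate_of_lt (by omega)]
      · rw [List.getElem?_eq_none (by simp; omega), List.getElem?_eq_none (by simp; omega)]
    · exact (not_some_a_and_some_b (hop.v_last hk1)
        (hoq.v_initial (by omega) (by omega))).elim

end Restivo
end

section
/- Let k ≥ 4 and let w be a minimal uncompletable word for S_k. Then u = b a^{k−1} is a prefix of w and v = b^{k−1} a is a suffix of w. -/
namespace Restivo

theorem append_mem_Pref_kstar {S : Set Word} {x w : Word} (hx : x ∈ S)
    (hw : w ∈ Pref (kstar S)) : x ++ w ∈ Pref (kstar S) := by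
  obtain ⟨z, L, hL, hz⟩ := hw
  exact ⟨z, x :: L, by simpa using ⟨hx, hL⟩, by simp [hz]⟩

theorem nil_mem_Pref_kstar (S : Set Word) : [] ∈ Pref (kstar S) :=
  ⟨[], [], by simp, rfl⟩

/-- Every word of length less than `k` is a suffix of a word of `Sk k`. -/
theorem exists_append_mem_Sk {k : ℕ} (hk : 4 ≤ k) {x : Word} (hx : x.length < k) :
    ∃ y : Word, y ++ x ∈ Sk k := by
  obtain ⟨n, hn⟩ := Nat.exists_eq_add_of_lt hx
  obtain ⟨m, rfl⟩ := Nat.exists_eq_add_of_le hk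
  refine ⟨List.replicate (n + 1) a, Or.inl ⟨by simp; omega, ?_, ?_⟩⟩
  · simp [u, List.replicate_succ, a, b]
  · have h : 4 + m - 1 = m + 2 + 1 := by omega
    simp [v, h, List.replicate_succ, a, b]

theorem mem_Facts_of_drop_mem_Pref {k j : ℕ} (hk : 4 ≤ k) (hj : j < k) {w : Word}
    (h : w.drop j ∈ Pref (kstar (Sk k))) : w ∈ Facts (kstar (Sk k)) := by
  obtain ⟨x, hx⟩ := exists_append_mem_Sk hk (x := w.take j) (by simp; omega)
  obtain ⟨z, hz⟩ := append_mem_Pref_kstar hx h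
  exact ⟨x, z, by simpa [List.append_assoc] using hz⟩

theorem length_le_of_mem_Sk {k : ℕ} {x : Word} (hx : x ∈ Sk k) : x.length ≤ k := by
  rcases hx with ⟨h, -⟩ | ⟨h, -⟩ <;> omega

theorem exists_drop_mem_Pref {k : ℕ} (hk : 0 < k) {S : Set Word}
    (hS : ∀ x ∈ S, x.length ≤ k) {w : Word} (h : w ∈ Facts (kstar S)) :
    ∃ j < k, w.drop j ∈ Pref (kstar S) := by
  obtain ⟨x, y, L, hL, h⟩ := h
  induction L generalizing x with
  | nil =>
    have hw : w = [] := by simp_all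
    exact ⟨0, hk, by simpa [hw] using nil_mem_Pref_kstar S⟩
  | cons l L ih =>
    have hL' : ∀ z ∈ L, z ∈ S := fun z hz => hL z (by simp [hz])
    have hl := hS l (hL l (by simp))
    rcases x with _ | ⟨c, x⟩
    · exact ⟨0, hk, y, l :: L, hL, by simpa using h⟩
    rw [List.flatten_cons, List.append_assoc, List.append_eq_append_iff] at h
    rcases h with ⟨x', -, h⟩ | ⟨e, he, h⟩
    · exact ih x' hL' (by simpa using h)
    · refine ⟨e.length, by simp [he] at hl; omega, ?_⟩
      rcases List.append_eq_append_iff.1 h with ⟨f, hf, -⟩ | ⟨f, hf, hy⟩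
      · rw [List.drop_eq_nil_of_le (by simp [hf])]
        exact nil_mem_Pref_kstar S
      · exact ⟨y, L, hL', by simpa [hf] using hy⟩

theorem u_isPrefix_of_minUncompletable {k : ℕ} (hk : 4 ≤ k) {w : Word}
    (hw : MinUncompletable (Sk k) w) : u k <+: w := by
  obtain ⟨hw, hmin⟩ := hw
  have hforb : ∀ j < k, w.drop j ∉ Pref (kstar (Sk k)) := fun j hj h =>
    hw (mem_Facts_of_drop_mem_Pref hk hj h)
  have hlen : k ≤ w.length := by
    by_contra! h
    exact hforb _ h (by simpa using nil_mem_Pref_kstar _)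
  have hfree : w.drop k ∈ Pref (kstar (Sk k)) := by
    have htail : w.drop 1 ∈ Facts (kstar (Sk k)) := by
      by_contra h
      have := hmin _ h
      simp at this
      omega
    obtain ⟨j, hj, h⟩ :=
      exists_drop_mem_Pref (by omega) (fun x => length_le_of_mem_Sk) htail
    rw [List.drop_drop] at h
    have hjk : ¬ 1 + j < k := fun h' => hforb _ h' h
    rwa [show 1 + j = k by omega] at h
  by_cases hu : w.take k = u k
  · exact hu ▸ List.take_prefix k w
  by_cases hv : w.take k = v k
  · exfalso
    apply hforb 1 (by omega)
    have hmem : (w.take k).drop 1 ∈ Sk k := by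
      obtain ⟨m, rfl⟩ := Nat.exists_eq_add_of_le hk
      have h : 4 + m - 1 = m + 2 + 1 := by omega
      refine Or.inr ⟨by simp; omega, ?_, ?_⟩
      · rw [hv, v, h]
        simp [List.replicate_succ, a, b]
      · rw [hv, v, h]
        intro h'
        simpa [List.replicate_succ, a, b] using congrArg (List.count a) h'
    have := append_mem_Pref_kstar hmem hfree
    rwa [← List.drop_append_of_le_length (by simp; omega), List.take_append_drop] at this
  · exact absurd
      (append_mem_Pref_kstar (Or.inl ⟨by simpa using hlen, hu, hv⟩) hfree)
      (by simpa using hforb 0 (by omega))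

/-- The involution of words that reverses them and exchanges the two letters. -/
def swapRev (w : Word) : Word := (w.map not).reverse

@[simp] theorem swapRev_swapRev (w : Word) : swapRev (swapRev w) = w := by
  simp [swapRev, Function.comp_def]

@[simp] theorem length_swapRev (w : Word) : (swapRev w).length = w.length := by
  simp [swapRev]

@[simp] theorem swapRev_append (x y : Word) :
    swapRev (x ++ y) = swapRev y ++ swapRev x := by
  simp [swapRev]

theorem swapRev_eq_iff {x y : Word} : swapRev x = y ↔ x = swapRev y :=
  ⟨fun h => by simp [← h], fun h => by simp [h]⟩

theorem swapRev_u (k : ℕ) : swapRev (u k) = v k := by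
  simp [swapRev, u, v, a, b]

theorem swapRev_v (k : ℕ) : swapRev (v k) = u k := by
  rw [← swapRev_u, swapRev_swapRev]

theorem swapRev_mem_Sk {k : ℕ} {x : Word} (hx : x ∈ Sk k) : swapRev x ∈ Sk k := by
  rcases hx with ⟨h, hu, hv⟩ | ⟨h, ha, hb⟩
  · exact Or.inl ⟨by simpa using h, by rwa [Ne, swapRev_eq_iff, swapRev_u],
      by rwa [Ne, swapRev_eq_iff, swapRev_v]⟩
  · refine Or.inr ⟨by simpa using h, ?_, ?_⟩ <;> rw [Ne, swapRev_eq_iff] <;>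
      simpa [swapRev, a, b] using ‹_›

theorem swapRev_mem_kstar {k : ℕ} {x : Word} (hx : x ∈ kstar (Sk k)) :
    swapRev x ∈ kstar (Sk k) := by
  obtain ⟨L, hL, rfl⟩ := hx
  refine ⟨(L.map swapRev).reverse, ?_, ?_⟩
  · intro x hx
    obtain ⟨y, hy, rfl⟩ : ∃ y ∈ L, swapRev y = x := by simpa using hx
    exact swapRev_mem_Sk (hL y hy)
  · clear hL
    induction L with
    | nil => rfl
    | cons l L ih => simp [ih]

theorem swapRev_mem_Facts {k : ℕ} {x : Word} (hx : x ∈ Facts (kstar (Sk k))) :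
    swapRev x ∈ Facts (kstar (Sk k)) := by
  obtain ⟨y, z, h⟩ := hx
  exact ⟨swapRev z, swapRev y, by simpa using swapRev_mem_kstar h⟩

theorem MinUncompletable.swapRev {k : ℕ} {w : Word} (hw : MinUncompletable (Sk k) w) :
    MinUncompletable (Sk k) (swapRev w) :=
  ⟨fun h => hw.1 (by simpa using swapRev_mem_Facts h),
    fun w' h => by simpa using hw.2 w' h⟩

theorem statement10 (k : ℕ) (hk : 4 ≤ k) (w : Word)
    (hw : MinUncompletable (Sk k) w) :
    (u k) <+: w ∧ (v k) <:+ w := by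
  refine ⟨u_isPrefix_of_minUncompletable hk hw, ?_⟩
  obtain ⟨z, hz⟩ := u_isPrefix_of_minUncompletable hk hw.swapRev
  exact ⟨swapRev z, by rw [← swapRev_u, ← swapRev_append, hz, swapRev_swapRev]⟩

end Restivo
end
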